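/- Let F be a field, W a finite-dimensional vector space over F, and fix natural numbers n, k, g, s with k ≥ 1. Let V be a function assigning to each subset S of a fixed n-element index set a linear subspace V(S) of W, satisfying: (i) V(S₁) ∩ V(S₂) = V(S₁ ∩ S₂) for all S₁, S₂; (ii) V(∅) = 0; (iii) dim V(S) = k·|S| + 1 − g for every S with k·|S| ≥ 2g − 1. If S₁, S₂ are subsets of size s with t := |S₁ ∩ S₂| satisfying k·t ≥ 2g − 1, then dist(V(S₁), V(S₂)) = 2k(s − t). -/

import Mathlib

/-- For the family of Riemann–Roch-type subspaces `V(S)`: if `S₁, S₂` are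
`s`-subsets with `t = |S₁ ∩ S₂|` and `kt ≥ 2g − 1`, then
`dist(V(S₁), V(S₂)) = 2k(s − t)`. -/
theorem kk_dist_of_inter_card (F W ι : Type*) [Field F] [AddCommGroup W] [Module F W]
    [FiniteDimensional F W] [Fintype ι] [DecidableEq ι] (n k g s : ℕ)
    (hn : Fintype.card ι = n) (hk : 1 ≤ k)
    (V : Finset ι → Submodule F W)
    (hinter : ∀ S₁ S₂ : Finset ι, V S₁ ⊓ V S₂ = V (S₁ ∩ S₂))
    (hempty : V ∅ = ⊥)
    (hdim : ∀ S : Finset ι, (2 * g : ℤ) - 1 ≤ (k : ℤ) * S.card →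
      (Module.finrank F ↥(V S) : ℤ) = (k : ℤ) * S.card + 1 - g)
    (S₁ S₂ : Finset ι) (hS₁ : S₁.card = s) (hS₂ : S₂.card = s)
    (t : ℕ) (ht : (S₁ ∩ S₂).card = t) (hkt : (2 * g : ℤ) - 1 ≤ (k : ℤ) * t) :
    (Module.finrank F ↥(V S₁ ⊔ V S₂) : ℤ) - (Module.finrank F ↥(V S₁ ⊓ V S₂) : ℤ) =
      2 * (k : ℤ) * ((s : ℤ) - t) := by
  have hts : t ≤ s := by
    rw [← ht, ← hS₁]
    exact Finset.card_le_card Finset.inter_subset_left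
  have hks : (2 * g : ℤ) - 1 ≤ (k : ℤ) * s := hkt.trans (by gcongr)
  have h₁ := hdim S₁ (by rwa [hS₁])
  have h₂ := hdim S₂ (by rwa [hS₂])
  have h₁₂ := hdim (S₁ ∩ S₂) (by rwa [ht])
  rw [hS₁] at h₁
  rw [hS₂] at h₂
  rw [ht, ← hinter] at h₁₂
  have hsum : (Module.finrank F ↥(V S₁ ⊔ V S₂) : ℤ) + Module.finrank F ↥(V S₁ ⊓ V S₂) =
      Module.finrank F ↥(V S₁) + Module.finrank F ↥(V S₂) := by
    exact_mod_cast Submodule.finrank_sup_add_finrank_inf_eq (V S₁) (V S₂)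
  linear_combination hsum + h₁ + h₂ - 2 * h₁₂
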